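/- If every irreducible unsatisfiable hitting CNF formula F has a resolution refutation of length polynomial in the number of clauses of F, then every unsatisfiable hitting CNF formula has a resolution refutation of length polynomial in its number of clauses. Precisely: if μ : ℕ → ℕ is non-decreasing and every irreducible unsatisfiable hitting formula F has a refutation of length at most μ(|F|), then every unsatisfiable hitting formula F has a refutation of length at most (|F| − 1)·μ(|F|) + 1. -/

import Mathlib

/-- A literal: a variable (natural number) with a polarity. -/
abbrev Lit : Type := ℕ × Bool

/-- Negation of a literal. -/
def Lit.neg (ℓ : Lit) : Lit := (ℓ.1, !ℓ.2)

/-- A clause: a finite set of literals. -/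
abbrev Clause : Type := Finset Lit

/-- A clause is non-tautological: it contains no literal together with its negation. -/
def Clause.NonTaut (C : Clause) : Prop := ∀ ℓ ∈ C, Lit.neg ℓ ∉ C

/-- A CNF formula: a finite set of clauses. -/
abbrev CNF : Type := Finset Clause

/-- A CNF formula is well-formed if all of its clauses are non-tautological. -/
def CNF.WellFormed (F : CNF) : Prop := ∀ C ∈ F, C.NonTaut

/-- A (total) assignment `τ` satisfies a literal. -/
def SatLit (τ : ℕ → Bool) (ℓ : Lit) : Prop := τ ℓ.1 = ℓ.2

/-- An assignment satisfies a clause if it satisfies some literal of it. -/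
def SatClause (τ : ℕ → Bool) (C : Clause) : Prop := ∃ ℓ ∈ C, SatLit τ ℓ

/-- An assignment satisfies a CNF formula if it satisfies all of its clauses. -/
def SatCNF (τ : ℕ → Bool) (F : CNF) : Prop := ∀ C ∈ F, SatClause τ C

/-- A CNF formula is unsatisfiable if no assignment satisfies it. -/
def Unsat (F : CNF) : Prop := ¬ ∃ τ : ℕ → Bool, SatCNF τ F

/-- `F` entails `G`: every model of `F` is a model of `G`. -/
def Entails (F G : CNF) : Prop := ∀ τ : ℕ → Bool, SatCNF τ F → SatCNF τ G

/-- Logical equivalence of CNF formulas. -/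
def Equivalent (F G : CNF) : Prop := Entails F G ∧ Entails G F

/-- Two clauses clash: one contains a literal whose negation is in the other. -/
def Clash (C D : Clause) : Prop := ∃ ℓ ∈ C, Lit.neg ℓ ∈ D

/-- A formula is hitting if every pair of distinct clauses clashes. -/
def Hitting (F : CNF) : Prop := ∀ C ∈ F, ∀ D ∈ F, C ≠ D → Clash C D

/-- The set of variables occurring in a CNF formula. -/
def cnfVars (F : CNF) : Finset ℕ := F.sup fun C => C.image Prod.fst

/-- `D` is the resolvent of `C₁` and `C₂` (on the unique clashing literal `ℓ`). -/
def Resolvent (C₁ C₂ D : Clause) : Prop :=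
  ∃ ℓ : Lit, C₁ ∩ C₂.image Lit.neg = {ℓ} ∧ D = (C₁ ∪ C₂) \ {ℓ, Lit.neg ℓ}

/-- `L` is a resolution refutation of `F`: every clause of the sequence is an axiom
(clause of `F`) or a resolvent of two earlier clauses, and the last clause is empty. -/
def IsRefutation (F : CNF) (L : List Clause) : Prop :=
  L ≠ [] ∧ L.getLast? = some (∅ : Clause) ∧
    ∀ i < L.length, L.getD i ∅ ∈ F ∨
      ∃ j k, j < i ∧ k < i ∧ Resolvent (L.getD j ∅) (L.getD k ∅) (L.getD i ∅)

/-- Resolution hardness: the minimum length of a resolution refutation. -/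
noncomputable def hardness (F : CNF) : ℕ :=
  sInf {n | ∃ L : List Clause, IsRefutation F L ∧ L.length = n}

/-- The restriction `F[¬C]`: the result of setting all literals of `C` to 0 in `F`. -/
def restrictByNegC (F : CNF) (C : Clause) : CNF :=
  (F.filter fun D => ∀ ℓ ∈ C, Lit.neg ℓ ∉ D).image fun D => D \ C

/-- `C` is a clause interpolant of `(F, H)`: `F ⊨ C` and `{C} ∪ H` is unsatisfiable. -/
def ClauseInterpolant (C : Clause) (F H : CNF) : Prop :=
  C.NonTaut ∧ Entails F {C} ∧ Unsat (insert C H)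

/-- `F` is a factor of `G`: a subset of `G` logically equivalent to a single clause. -/
def IsFactor (F G : CNF) : Prop :=
  F ⊆ G ∧ ∃ C : Clause, C.NonTaut ∧ Equivalent F {C}

/-- `F` is a pseudo-factor of `G`: `(F, G \ F)` has a clause interpolant. -/
def IsPseudoFactor (F G : CNF) : Prop :=
  F ⊆ G ∧ ∃ C : Clause, ClauseInterpolant C F (G \ F)

/-- `G` is irreducible: every factor has size 1 or `|G|`. -/
def CNF.Irreducible (G : CNF) : Prop :=
  ∀ F : CNF, IsFactor F G → F.card = 1 ∨ F.card = G.card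

/-- `G` is strongly irreducible: every pseudo-factor has size 1 or `|G|`. -/
def StronglyIrreducible (G : CNF) : Prop :=
  ∀ F : CNF, IsPseudoFactor F G → F.card = 1 ∨ F.card = G.card

/-- `F` is minimally unsatisfiable: unsatisfiable, but every proper subset is satisfiable. -/
def MinimallyUnsat (F : CNF) : Prop :=
  Unsat F ∧ ∀ G : CNF, G ⊂ F → ∃ τ : ℕ → Bool, SatCNF τ G

theorem Lit.neg_neg (ℓ : Lit) : Lit.neg (Lit.neg ℓ) = ℓ := by
  simp [Lit.neg]

theorem satLit_neg (τ : ℕ → Bool) (ℓ : Lit) : SatLit τ (Lit.neg ℓ) ↔ ¬ SatLit τ ℓ := by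
  unfold SatLit Lit.neg
  cases τ ℓ.1 <;> cases ℓ.2 <;> simp

theorem mem_image_neg {C : Clause} {ℓ : Lit} : ℓ ∈ C.image Lit.neg ↔ Lit.neg ℓ ∈ C := by
  constructor
  · intro h
    obtain ⟨x, hx, rfl⟩ := Finset.mem_image.1 h
    rwa [Lit.neg_neg]
  · exact fun h => Finset.mem_image.2 ⟨_, h, Lit.neg_neg ℓ⟩

theorem Clash.symm {C D : Clause} (h : Clash C D) : Clash D C := by
  obtain ⟨ℓ, hC, hD⟩ := h
  exact ⟨Lit.neg ℓ, hD, by rwa [Lit.neg_neg]⟩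

theorem satCNF_singleton {τ : ℕ → Bool} {C : Clause} : SatCNF τ {C} ↔ SatClause τ C := by
  simp [SatCNF]

theorem satCNF_insert {τ : ℕ → Bool} {C : Clause} {F : CNF} :
    SatCNF τ (insert C F) ↔ SatClause τ C ∧ SatCNF τ F := by
  simp [SatCNF]

/-- Every assignment can be changed on the variables of a non-tautological clause so that it
falsifies the clause. -/
theorem Clause.NonTaut.exists_falsifying {C : Clause} (hC : C.NonTaut) (τ : ℕ → Bool) :
    ∃ σ : ℕ → Bool, ¬ SatClause σ C ∧
      ∀ ℓ : Lit, ℓ ∉ C → Lit.neg ℓ ∉ C → SatLit τ ℓ → SatLit σ ℓ := by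
  refine ⟨fun v => if (v, false) ∈ C then true else if (v, true) ∈ C then false else τ v, ?_, ?_⟩
  · rintro ⟨⟨v, b⟩, hv, hs⟩
    have hn := hC _ hv
    cases b <;> simp_all [SatLit, Lit.neg]
  · rintro ⟨v, b⟩ h₁ h₂ h₃
    cases b <;> simp_all [SatLit, Lit.neg]

theorem subset_of_entails {C D : Clause} (hD : D.NonTaut)
    (h : ∀ τ : ℕ → Bool, SatClause τ C → SatClause τ D) : C ⊆ D := by
  intro ℓ hℓ
  by_contra hn
  by_cases hneg : Lit.neg ℓ ∈ D
  · obtain ⟨σ, hσ, -⟩ := hD.exists_falsifying fun _ => false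
    refine hσ (h σ ⟨ℓ, hℓ, ?_⟩)
    by_contra hs
    exact hσ ⟨_, hneg, (satLit_neg σ ℓ).2 hs⟩
  · obtain ⟨σ, hσ, hsat⟩ := hD.exists_falsifying fun _ => ℓ.2
    exact hσ (h σ ⟨ℓ, hℓ, hsat ℓ hn hneg rfl⟩)

theorem nonTaut_union {C D : Clause} (hC : C.NonTaut) (hD : D.NonTaut) (h : ¬ Clash C D) :
    Clause.NonTaut (C ∪ D) := by
  intro ℓ hℓ hn
  rcases Finset.mem_union.1 hℓ with h₁ | h₁ <;> rcases Finset.mem_union.1 hn with h₂ | h₂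
  · exact hC _ h₁ h₂
  · exact h ⟨_, h₁, h₂⟩
  · exact h (Clash.symm ⟨_, h₁, h₂⟩)
  · exact hD _ h₁ h₂

theorem SatClause.mono {τ : ℕ → Bool} {C D : Clause} (h : C ⊆ D) (hC : SatClause τ C) :
    SatClause τ D := by
  obtain ⟨ℓ, hℓ, hs⟩ := hC
  exact ⟨ℓ, h hℓ, hs⟩

theorem Clash.satClause {τ : ℕ → Bool} {C D : Clause} (h : Clash C D) (hC : ¬ SatClause τ C) :
    SatClause τ D := by
  obtain ⟨ℓ, h₁, h₂⟩ := h
  exact ⟨_, h₂, (satLit_neg τ ℓ).2 fun hs => hC ⟨ℓ, h₁, hs⟩⟩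

/-- Resolution derivations, with the most recent clause at the head of the list. -/
inductive ResDerivation (F : CNF) : List Clause → Prop
  | nil : ResDerivation F []
  | cons {C : Clause} {L : List Clause} (hL : ResDerivation F L)
      (hC : C ∈ F ∨ ∃ A ∈ L, ∃ B ∈ L, Resolvent A B C) : ResDerivation F (C :: L)

theorem derivation_reverse {F : CNF} (L : List Clause)
    (h : ∀ i < L.length, L.getD i ∅ ∈ F ∨
      ∃ j k, j < i ∧ k < i ∧ Resolvent (L.getD j ∅) (L.getD k ∅) (L.getD i ∅)) :
    ResDerivation F L.reverse := by
  induction L using List.reverseRecOn with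
  | nil => exact .nil
  | append_singleton L C ih =>
    rw [List.reverse_append, List.reverse_singleton, List.singleton_append]
    have hlt : ∀ i < L.length, (L ++ [C]).getD i ∅ = L.getD i ∅ := fun i hi =>
      List.getD_append _ _ _ _ hi
    have hmem : ∀ i < L.length, L.getD i ∅ ∈ L.reverse := fun i hi => by
      rw [List.getD_eq_getElem _ _ hi, List.mem_reverse]
      exact List.getElem_mem hi
    have hlast : (L ++ [C]).getD L.length ∅ = C := by simp
    refine .cons (ih fun i hi => ?_) ?_
    · have hi' := h i (by simp; omega)
      rw [hlt i hi] at hi'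
      refine hi'.imp_right ?_
      rintro ⟨j, k, hj, hk, hr⟩
      rw [hlt j (hj.trans hi), hlt k (hk.trans hi)] at hr
      exact ⟨j, k, hj, hk, hr⟩
    · have hi' := h L.length (by simp)
      rw [hlast] at hi'
      refine hi'.imp_right ?_
      rintro ⟨j, k, hj, hk, hr⟩
      rw [hlt j hj, hlt k hk] at hr
      exact ⟨_, hmem j hj, _, hmem k hk, hr⟩

theorem ResDerivation.forall_getD_reverse {F : CNF} {L : List Clause} (h : ResDerivation F L) :
    ∀ i < L.reverse.length, L.reverse.getD i ∅ ∈ F ∨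
      ∃ j k, j < i ∧ k < i ∧
        Resolvent (L.reverse.getD j ∅) (L.reverse.getD k ∅) (L.reverse.getD i ∅) := by
  induction h with
  | nil => simp
  | @cons C L hL hC ih =>
    rw [List.reverse_cons]
    have hlt : ∀ i < L.reverse.length, (L.reverse ++ [C]).getD i ∅ = L.reverse.getD i ∅ :=
      fun i hi => List.getD_append _ _ _ _ hi
    have hlast : (L.reverse ++ [C]).getD L.reverse.length ∅ = C := by simp
    have hidx : ∀ A ∈ L, ∃ j < L.reverse.length, L.reverse.getD j ∅ = A := fun A hA => by
      obtain ⟨j, hj, hjA⟩ := List.getElem_of_mem (List.mem_reverse.2 hA)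
      exact ⟨j, hj, by rw [List.getD_eq_getElem _ _ hj, hjA]⟩
    intro i hi
    rcases Nat.lt_or_ge i L.reverse.length with hi' | hi'
    · rw [hlt i hi']
      refine (ih i hi').imp_right ?_
      rintro ⟨j, k, hj, hk, hr⟩
      refine ⟨j, k, hj, hk, ?_⟩
      rwa [hlt j (hj.trans hi'), hlt k (hk.trans hi')]
    · obtain rfl : i = L.reverse.length := by
        rw [List.length_append, List.length_singleton] at hi
        omega
      rw [hlast]
      refine hC.imp_right ?_
      rintro ⟨A, hA, B, hB, hr⟩
      obtain ⟨j, hj, rfl⟩ := hidx A hA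
      obtain ⟨k, hk, rfl⟩ := hidx B hB
      refine ⟨j, k, hj, hk, ?_⟩
      rwa [hlt j hj, hlt k hk]

theorem IsRefutation.exists_derivation {F : CNF} {L : List Clause} (h : IsRefutation F L) :
    ∃ M : List Clause, ResDerivation F M ∧ ∅ ∈ M ∧ M.length = L.length := by
  refine ⟨L.reverse, derivation_reverse L h.2.2, ?_, by simp⟩
  rw [List.mem_reverse]
  exact List.mem_of_getLast? h.2.1

theorem ResDerivation.exists_head {F : CNF} {L : List Clause} (h : ResDerivation F L) {C : Clause}
    (hC : C ∈ L) : ∃ M, ResDerivation F (C :: M) ∧ M.length + 1 ≤ L.length := by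
  induction h with
  | nil => simp at hC
  | @cons D L hL hD ih =>
    by_cases hCL : C ∈ L
    · obtain ⟨M, hM, hlen⟩ := ih hCL
      exact ⟨M, hM, by simp; omega⟩
    · obtain rfl : C = D := (List.mem_cons.1 hC).resolve_right hCL
      exact ⟨L, .cons hL hD, by simp⟩

theorem ResDerivation.exists_isRefutation {F : CNF} {L : List Clause} (h : ResDerivation F L)
    (hL : ∅ ∈ L) : ∃ M, IsRefutation F M ∧ M.length ≤ L.length := by
  obtain ⟨M, hM, hlen⟩ := h.exists_head hL
  exact ⟨(∅ :: M).reverse, ⟨by simp, by simp, hM.forall_getD_reverse⟩, by simpa using hlen⟩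

/-- Axioms derived in `M` can be removed from a derivation that is appended to `M`. -/
theorem ResDerivation.filter_append {F H : CNF} {C : Clause} {L M : List Clause}
    (hL : ResDerivation (insert C H) L) (hM : ResDerivation F M) (hC : C ∈ M) (hHF : H ⊆ F) :
    ResDerivation F (L.filter (fun D => D ≠ C) ++ M) := by
  induction hL with
  | nil => exact hM
  | @cons D L _ hD ih =>
    by_cases hDC : D = C
    · simpa [hDC] using ih
    · rw [List.filter_cons_of_pos (by simpa using hDC), List.cons_append]
      have hmem : ∀ A ∈ L, A ∈ L.filter (fun D => D ≠ C) ++ M := fun A hA => by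
        by_cases hAC : A = C
        · exact List.mem_append_right _ (hAC ▸ hC)
        · exact List.mem_append_left _ (List.mem_filter.2 ⟨hA, by simpa using hAC⟩)
      refine .cons ih (hD.imp (fun h => hHF ((Finset.mem_insert.1 h).resolve_left hDC)) ?_)
      rintro ⟨A, hA, B, hB, hr⟩
      exact ⟨A, hmem A hA, B, hmem B hB, hr⟩

theorem ResDerivation.of_insert_of_notMem {F H : CNF} {C : Clause} {L : List Clause}
    (hL : ResDerivation (insert C H) L) (hC : C ∉ L) (hHF : H ⊆ F) : ResDerivation F L := by
  induction hL with
  | nil => exact .nil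
  | @cons D L _ hD ih =>
    rw [List.mem_cons, not_or] at hC
    exact .cons (ih hC.2)
      (hD.imp_left fun h => hHF ((Finset.mem_insert.1 h).resolve_left (Ne.symm hC.1)))

/-- No variable of `C` occurs in `D`. -/
def VarDisjoint (C D : Clause) : Prop := ∀ ℓ ∈ D, ℓ ∉ C ∧ Lit.neg ℓ ∉ C

theorem Resolvent.varDisjoint {A B C D : Clause} (h : Resolvent A B D) (hA : VarDisjoint C A)
    (hB : VarDisjoint C B) : VarDisjoint C D := by
  obtain ⟨x, -, rfl⟩ := h
  intro ℓ hℓ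
  exact (Finset.mem_union.1 (Finset.mem_sdiff.1 hℓ).1).elim (hA ℓ) (hB ℓ)

theorem Resolvent.union {A B C D : Clause} (hC : C.NonTaut) (h : Resolvent A B D)
    (hA : VarDisjoint C A) (hB : VarDisjoint C B) : Resolvent (A ∪ C) (B ∪ C) (D ∪ C) := by
  obtain ⟨x, hx, rfl⟩ := h
  have hx' : ∀ ℓ, (ℓ ∈ A ∧ Lit.neg ℓ ∈ B) ↔ ℓ = x := fun ℓ => by
    rw [← Finset.mem_singleton, ← hx, Finset.mem_inter, mem_image_neg]
  have hxA : x ∈ A := ((hx' x).2 rfl).1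
  refine ⟨x, ?_, ?_⟩
  · ext ℓ
    rw [Finset.mem_inter, mem_image_neg, Finset.mem_union, Finset.mem_union,
      Finset.mem_singleton, ← hx' ℓ]
    have hA' := hA ℓ
    have hB' := hB (Lit.neg ℓ)
    have hC' := hC ℓ
    rw [Lit.neg_neg] at hB'
    tauto
  · ext ℓ
    have h₁ : ℓ ∈ C → ℓ ≠ x := fun h e => (hA x hxA).1 (e ▸ h)
    have h₂ : ℓ ∈ C → ℓ ≠ Lit.neg x := fun h e => (hA x hxA).2 (e ▸ h)
    simp only [Finset.mem_union, Finset.mem_sdiff, Finset.mem_insert, Finset.mem_singleton]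
    tauto

theorem ResDerivation.varDisjoint {F : CNF} {C : Clause} (hF : ∀ D ∈ F, VarDisjoint C D)
    {L : List Clause} (h : ResDerivation F L) : ∀ D ∈ L, VarDisjoint C D := by
  induction h with
  | nil => simp
  | cons _ hD ih =>
    rintro E hE
    rcases List.mem_cons.1 hE with rfl | hE
    · rcases hD with hD | ⟨A, hA, B, hB, hr⟩
      · exact hF _ hD
      · exact hr.varDisjoint (ih A hA) (ih B hB)
    · exact ih E hE

theorem ResDerivation.map_union {F G : CNF} {C : Clause} (hC : C.NonTaut)
    (hF : ∀ D ∈ F, VarDisjoint C D) (hG : ∀ D ∈ F, D ∪ C ∈ G) {L : List Clause}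
    (h : ResDerivation F L) : ResDerivation G (L.map fun D => D ∪ C) := by
  induction h with
  | nil => exact .nil
  | cons hL hD ih =>
    refine .cons ih (hD.imp (hG _) ?_)
    rintro ⟨A, hA, B, hB, hr⟩
    have hdisj := hL.varDisjoint hF
    exact ⟨_, List.mem_map_of_mem hA, _, List.mem_map_of_mem hB,
      hr.union hC (hdisj A hA) (hdisj B hB)⟩

section Factor

variable {F G : CNF} {C : Clause}

theorem subset_of_equivalent (hF : F.WellFormed) (h : Equivalent F {C}) {D : Clause}
    (hD : D ∈ F) : C ⊆ D :=
  subset_of_entails (hF D hD) fun τ hτ => h.2 τ (satCNF_singleton.2 hτ) D hD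

theorem varDisjoint_sdiff {D : Clause} (hD : D.NonTaut) (hCD : C ⊆ D) : VarDisjoint C (D \ C) :=
  fun ℓ hℓ => ⟨(Finset.mem_sdiff.1 hℓ).2, fun hn => hD ℓ (Finset.mem_sdiff.1 hℓ).1 (hCD hn)⟩

theorem hitting_image_sdiff (hF : F.WellFormed) (hFh : Hitting F) (hsub : ∀ D ∈ F, C ⊆ D) :
    Hitting (F.image fun D => D \ C) := by
  intro D₁ h₁ D₂ h₂ hne
  obtain ⟨E₁, hE₁, rfl⟩ := Finset.mem_image.1 h₁
  obtain ⟨E₂, hE₂, rfl⟩ := Finset.mem_image.1 h₂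
  obtain ⟨ℓ, hℓ₁, hℓ₂⟩ := hFh E₁ hE₁ E₂ hE₂ fun h => hne (by rw [h])
  exact ⟨ℓ, Finset.mem_sdiff.2 ⟨hℓ₁, fun h => hF E₂ hE₂ ℓ (hsub E₂ hE₂ h) hℓ₂⟩,
    Finset.mem_sdiff.2 ⟨hℓ₂, fun h => hF E₁ hE₁ ℓ hℓ₁ (hsub E₁ hE₁ h)⟩⟩

theorem unsat_image_sdiff (hF : F.WellFormed) (hC : C.NonTaut) (h : Equivalent F {C}) :
    Unsat (F.image fun D => D \ C) := by
  rintro ⟨τ, hτ⟩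
  obtain ⟨σ, hσ, hsat⟩ := hC.exists_falsifying τ
  refine hσ (satCNF_singleton.1 (h.1 σ fun D hD => ?_))
  obtain ⟨ℓ, hℓ, hs⟩ := hτ _ (Finset.mem_image_of_mem _ hD)
  have hd := varDisjoint_sdiff (hF D hD) (subset_of_equivalent hF h hD) ℓ hℓ
  exact ⟨ℓ, (Finset.mem_sdiff.1 hℓ).1, hsat ℓ hd.1 hd.2 hs⟩

theorem clash_of_factor (hG : G.WellFormed) (hGh : Hitting G) (hFG : F ⊆ G) (hC : C.NonTaut)
    (h : Equivalent F {C}) {D : Clause} (hD : D ∈ G \ F) : Clash C D := by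
  obtain ⟨hDG, hDF⟩ := Finset.mem_sdiff.1 hD
  by_contra hn
  obtain ⟨σ, hσ, -⟩ := (nonTaut_union hC (hG D hDG) hn).exists_falsifying fun _ => false
  refine hσ (.mono Finset.subset_union_left (satCNF_singleton.1 (h.1 σ fun E hE => ?_)))
  exact (hGh D hDG E (hFG hE) (by rintro rfl; exact hDF hE)).satClause
    fun hs => hσ (hs.mono Finset.subset_union_right)

theorem hitting_insert_sdiff (hG : G.WellFormed) (hGh : Hitting G) (hFG : F ⊆ G) (hC : C.NonTaut)
    (h : Equivalent F {C}) : Hitting (insert C (G \ F)) := by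
  intro D₁ h₁ D₂ h₂ hne
  rcases Finset.mem_insert.1 h₁ with rfl | h₁' <;> rcases Finset.mem_insert.1 h₂ with rfl | h₂'
  · exact absurd rfl hne
  · exact clash_of_factor hG hGh hFG hC h h₂'
  · exact (clash_of_factor hG hGh hFG hC h h₁').symm
  · exact hGh _ (Finset.mem_sdiff.1 h₁').1 _ (Finset.mem_sdiff.1 h₂').1 hne

theorem unsat_insert_sdiff (hG : Unsat G) (h : Equivalent F {C}) :
    Unsat (insert C (G \ F)) := by
  rintro ⟨τ, hτ⟩
  rw [satCNF_insert] at hτ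
  refine hG ⟨τ, fun D hD => ?_⟩
  by_cases hDF : D ∈ F
  · exact h.2 τ (satCNF_singleton.2 hτ.1) D hDF
  · exact hτ.2 D (Finset.mem_sdiff.2 ⟨hD, hDF⟩)

theorem card_pos_of_equivalent (hC : C.NonTaut) (h : Equivalent F {C}) : 0 < F.card := by
  rw [Finset.card_pos, Finset.nonempty_iff_ne_empty]
  rintro rfl
  obtain ⟨σ, hσ, -⟩ := hC.exists_falsifying fun _ => false
  exact hσ (satCNF_singleton.1 (h.1 σ fun D hD => absurd hD (Finset.notMem_empty D)))

/-- Refutations of the restricted factor and of the formula with the factor contracted to its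
clause combine to a refutation of the whole formula. -/
theorem exists_derivation_of_factor (hG : G.WellFormed) (hFG : F ⊆ G) (hC : C.NonTaut)
    (h : Equivalent F {C}) {L M : List Clause} (hM : ResDerivation (F.image fun D => D \ C) M)
    (hMe : ∅ ∈ M) (hL : ResDerivation (insert C (G \ F)) L) (hLe : ∅ ∈ L) :
    ∃ N, ResDerivation G N ∧ ∅ ∈ N ∧ N.length + 1 ≤ L.length + M.length := by
  have hF : F.WellFormed := fun D hD => hG D (hFG hD)
  have hsub : ∀ D ∈ F, C ⊆ D := fun D hD => subset_of_equivalent hF h hD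
  have hM' : ResDerivation G (M.map fun D => D ∪ C) := by
    refine hM.map_union hC (Finset.forall_mem_image.2 fun D hD => ?_)
      (Finset.forall_mem_image.2 fun D hD => ?_)
    · exact varDisjoint_sdiff (hF D hD) (hsub D hD)
    · rw [Finset.sdiff_union_of_subset (hsub D hD)]
      exact hFG hD
  have hCM : C ∈ M.map fun D => D ∪ C := List.mem_map.2 ⟨∅, hMe, Finset.empty_union C⟩
  have hLpos := List.length_pos_of_mem hLe
  have hMpos := List.length_pos_of_mem hMe
  by_cases hC₀ : C = ∅
  · exact ⟨_, hM', hC₀ ▸ hCM, by rw [List.length_map]; omega⟩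
  by_cases hCL : C ∈ L
  · refine ⟨_, hL.filter_append hM' hCM Finset.sdiff_subset, ?_, ?_⟩
    · exact List.mem_append_left _ (List.mem_filter.2 ⟨hLe, by simpa using Ne.symm hC₀⟩)
    · have hlt : (L.filter fun D => D ≠ C).length < L.length :=
        List.length_filter_lt_length_iff_exists.2 ⟨C, hCL, by simp⟩
      rw [List.length_append, List.length_map]
      omega
  · exact ⟨L, hL.of_insert_of_notMem hCL Finset.sdiff_subset, hLe, by omega⟩

end Factor

theorem exists_derivation_of_irreducible {μ : ℕ → ℕ}
    (hbase : ∀ F : CNF, F.WellFormed → Hitting F → Unsat F → F.Irreducible →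
      ∃ L : List Clause, IsRefutation F L ∧ L.length ≤ μ F.card)
    {F : CNF} (hF : F.WellFormed) (hFh : Hitting F) (hFu : Unsat F) (hFi : F.Irreducible) :
    ∃ L : List Clause, ResDerivation F L ∧ ∅ ∈ L ∧ L.length ≤ (F.card - 1) * μ F.card + 1 := by
  rcases Nat.lt_or_ge 1 F.card with hcard | hcard
  · obtain ⟨L, hL, hlen⟩ := hbase F hF hFh hFu hFi
    obtain ⟨M, hM, hMe, hMlen⟩ := hL.exists_derivation
    refine ⟨M, hM, hMe, ?_⟩
    have := Nat.le_mul_of_pos_left (μ F.card) (Nat.sub_pos_of_lt hcard)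
    omega
  · have hempty : ∅ ∈ F := by
      rcases F.eq_empty_or_nonempty with rfl | ⟨D, hD⟩
      · exact absurd ⟨fun _ => false, fun D hD => absurd hD (Finset.notMem_empty D)⟩ hFu
      · rcases D.eq_empty_or_nonempty with rfl | ⟨ℓ, hℓ⟩
        · exact hD
        · refine absurd ⟨fun _ => ℓ.2, fun E hE => ?_⟩ hFu
          rw [Finset.card_le_one.1 hcard E hE D hD]
          exact ⟨ℓ, hℓ, rfl⟩
    exact ⟨[∅], .cons .nil (.inl hempty), by simp, by simp⟩

theorem exists_derivation_of_hitting {μ : ℕ → ℕ} (hmono : Monotone μ)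
    (hbase : ∀ F : CNF, F.WellFormed → Hitting F → Unsat F → F.Irreducible →
      ∃ L : List Clause, IsRefutation F L ∧ L.length ≤ μ F.card)
    (G : CNF) (hG : G.WellFormed) (hGh : Hitting G) (hGu : Unsat G) :
    ∃ L : List Clause, ResDerivation G L ∧ ∅ ∈ L ∧ L.length ≤ (G.card - 1) * μ G.card + 1 := by
  induction hn : G.card using Nat.strong_induction_on generalizing G with
  | _ n ih =>
    subst hn
    by_cases hGi : G.Irreducible
    · exact exists_derivation_of_irreducible hbase hG hGh hGu hGi
    simp only [CNF.Irreducible, not_forall, not_or] at hGi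
    obtain ⟨F, ⟨hFG, C, hC, h⟩, hne₁, hne₂⟩ := hGi
    have hF : F.WellFormed := fun D hD => hG D (hFG hD)
    have hsub : ∀ D ∈ F, C ⊆ D := fun D hD => subset_of_equivalent hF h hD
    have hpos := card_pos_of_equivalent hC h
    have hle := Finset.card_le_card hFG
    have hcard₁ : (F.image fun D => D \ C).card ≤ F.card := Finset.card_image_le
    have hcard₂ : (insert C (G \ F)).card ≤ G.card - F.card + 1 :=
      (Finset.card_insert_le _ _).trans_eq (by rw [Finset.card_sdiff_of_subset hFG])
    obtain ⟨M, hM, hMe, hMlen⟩ := ih _ (by omega) (F.image fun D => D \ C)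
      (Finset.forall_mem_image.2 fun D hD ℓ hℓ hn =>
        hF D hD ℓ (Finset.mem_sdiff.1 hℓ).1 (Finset.mem_sdiff.1 hn).1)
      (hitting_image_sdiff hF (fun D hD E hE => hGh D (hFG hD) E (hFG hE)) hsub)
      (unsat_image_sdiff hF hC h) rfl
    obtain ⟨L, hL, hLe, hLlen⟩ := ih _ (by omega) (insert C (G \ F))
      (Finset.forall_mem_insert _ _ _ |>.2 ⟨hC, fun D hD => hG D (Finset.mem_sdiff.1 hD).1⟩)
      (hitting_insert_sdiff hG hGh hFG hC h) (unsat_insert_sdiff hGu h) rfl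
    obtain ⟨N, hN, hNe, hNlen⟩ := exists_derivation_of_factor hG hFG hC h hM hMe hL hLe
    refine ⟨N, hN, hNe, ?_⟩
    have hb₁ : ((F.image fun D => D \ C).card - 1) * μ (F.image fun D => D \ C).card ≤
        (F.card - 1) * μ G.card :=
      Nat.mul_le_mul (by omega) (hmono (by omega))
    have hb₂ : ((insert C (G \ F)).card - 1) * μ (insert C (G \ F)).card ≤
        (G.card - F.card) * μ G.card :=
      Nat.mul_le_mul (by omega) (hmono (by omega))
    have hsum : (F.card - 1) * μ G.card + (G.card - F.card) * μ G.card =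
        (G.card - 1) * μ G.card := by
      rw [← Nat.add_mul]
      congr 1
      omega
    omega

/-- if `μ` is non-decreasing and every irreducible unsatisfiable hitting
formula `F` has a resolution refutation of length at most `μ(|F|)`, then every
unsatisfiable hitting formula `F` has a resolution refutation of length at most
`(|F| − 1)·μ(|F|) + 1`. -/
theorem hitting_polysize_from_irreducible (μ : ℕ → ℕ) (hmono : Monotone μ)
    (hbase : ∀ F : CNF, F.WellFormed → Hitting F → Unsat F → F.Irreducible →
      ∃ L : List Clause, IsRefutation F L ∧ L.length ≤ μ F.card) :
    ∀ F : CNF, F.WellFormed → Hitting F → Unsat F →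
      ∃ L : List Clause, IsRefutation F L ∧
        L.length ≤ (F.card - 1) * μ F.card + 1 := by
  intro F hF hFh hFu
  obtain ⟨L, hL, hLe, hlen⟩ := exists_derivation_of_hitting hmono hbase F hF hFh hFu
  obtain ⟨M, hM, hMlen⟩ := hL.exists_isRefutation hLe
  exact ⟨M, hM, hMlen.trans hlen⟩
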